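/- Fix 2 ≤ n ∈ ℕ, let R := ℤ/(n), and let λ be the length function on R-modules given by λ(M) := log_n(card M) (with λ(M) = ∞ if M is infinite). Let S = R[x₁,…,x_k], let J < S be an ideal, and let A := S/J. Then the λ-dimension of A equals the Krull dimension of A. -/

import Mathlib

open scoped ENNReal

/-- A (generalized) length function on the category of `R`-modules, with values in
`ℝ≥0 ∪ {∞} = ℝ≥0∞`: it vanishes on the zero module, is invariant under isomorphism, is additive
on short exact sequences (equivalently, `λ(M) = λ(N) + λ(M/N)` for every submodule `N ≤ M`), and
is the supremum of its values on finitely generated submodules. -/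
structure LengthFunction (R : Type) [CommRing R] : Type 1 where
  l : (M : Type) → [AddCommGroup M] → [Module R M] → ℝ≥0∞
  l_zero : ∀ (M : Type) [AddCommGroup M] [Module R M], Subsingleton M → l M = 0
  l_congr : ∀ (M N : Type) [AddCommGroup M] [Module R M] [AddCommGroup N] [Module R N],
      (M ≃ₗ[R] N) → l M = l N
  l_add : ∀ (M : Type) [AddCommGroup M] [Module R M] (N : Submodule R M),
      l M = l N + l (M ⧸ N)
  l_fg_sup : ∀ (M : Type) [AddCommGroup M] [Module R M],
      l M = ⨆ (N : Submodule R M) (_ : N.FG), l N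

/-- `Sₙ · V`: the `R`-submodule of `M` generated by the products `p • v` with `p ∈ Sₙ` (the
polynomials of total degree at most `n` in `S = R[x₁,…,x_k]`) and `v ∈ V`. -/
def degSmul {R : Type} [CommRing R] (k : ℕ) {M : Type} [AddCommGroup M] [Module R M]
    [Module (MvPolynomial (Fin k) R) M] [IsScalarTower R (MvPolynomial (Fin k) R) M]
    (n : ℕ) (V : Submodule R M) : Submodule R M :=
  Submodule.span R
    {m : M | ∃ p ∈ MvPolynomial.restrictTotalDegree (Fin k) R n, ∃ v ∈ V, p • v = m}

theorem ringKrullDim_le_of_isIntegral {R S : Type*} [CommRing R] [CommRing S] (f : R →+* S)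
    (hf : f.IsIntegral) : ringKrullDim S ≤ ringKrullDim R := by
  algebraize [f]
  refine Order.krullDim_le_of_strictMono (PrimeSpectrum.comap f) fun P Q h ↦ ?_
  exact Ideal.IsIntegral.comap_lt_comap (R := R) (I := P.asIdeal) (J := Q.asIdeal) h

theorem le_ringKrullDim_of_isIntegral_of_injective {R S : Type*} [CommRing R] [CommRing S]
    (f : R →+* S) (hf : f.IsIntegral) (hinj : Function.Injective f) :
    ringKrullDim R ≤ ringKrullDim S := by
  algebraize [f]
  refine iSup_le fun l ↦ ?_
  obtain ⟨P, -, hP, hP'⟩ := Ideal.exists_ideal_over_prime_of_isIntegral (S := S)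
    (RelSeries.head l).asIdeal (⊥ : Ideal S) (by
      rw [← RingHom.ker_eq_comap_bot, (RingHom.injective_iff_ker_eq_bot (algebraMap R S)).mp hinj]
      exact bot_le)
  have : P.LiesOver (RelSeries.head l).asIdeal := ⟨hP'.symm⟩
  obtain ⟨L, hL, -⟩ := Ideal.exists_ltSeries_of_hasGoingUp l P
  rw [← hL]
  exact Order.LTSeries.length_le_krullDim L

open Filter in
theorem Polynomial.natDegree_le_of_eventually_le (q : Polynomial ℝ) (C : ℝ) (d : ℕ)
    (h : ∀ᶠ m : ℕ in atTop, |q.eval (m : ℝ)| ≤ C * (m : ℝ) ^ d) : q.natDegree ≤ d := by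
  by_contra! hd
  have h1 := (q.abs_div_tendsto_atTop_atTop_of_degree_gt (Polynomial.X ^ d)
    (by
      rw [Polynomial.degree_X_pow, Polynomial.degree_eq_natDegree (by rintro rfl; simp at hd)]
      exact_mod_cast hd)
    (Polynomial.monic_X_pow d).ne_zero).comp tendsto_natCast_atTop_atTop
  obtain ⟨m, h1, h2, h3⟩ := ((h1.eventually_gt_atTop C).and
    (h.and (eventually_gt_atTop 0))).exists
  have : (0 : ℝ) < (m : ℝ) ^ d := by positivity
  simp only [Function.comp, Polynomial.eval_pow, Polynomial.eval_X, abs_div, abs_of_pos this] at h1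
  rw [lt_div_iff₀ this] at h1
  linarith

open Filter in
theorem Polynomial.le_natDegree_of_eventually_le (q : Polynomial ℝ) (c : ℝ) (hc : 0 < c) (d : ℕ)
    (h : ∀ᶠ m : ℕ in atTop, c * (m : ℝ) ^ d ≤ q.eval (m : ℝ)) : d ≤ q.natDegree := by
  by_contra! hd
  have h1 := (q.div_tendsto_atTop_zero_of_degree_lt (Polynomial.X ^ d)
    (by
      rw [Polynomial.degree_X_pow]
      exact Polynomial.degree_le_natDegree.trans_lt (by exact_mod_cast hd))).comp
        tendsto_natCast_atTop_atTop
  obtain ⟨m, h1, h2, h3⟩ := ((h1.eventually_lt_const hc).and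
    (h.and (eventually_gt_atTop 0))).exists
  have : (0 : ℝ) < (m : ℝ) ^ d := by positivity
  simp only [Function.comp, Polynomial.eval_pow, Polynomial.eval_X] at h1
  rw [div_lt_iff₀ this] at h1
  linarith

/-- Two distinct finite sets of monomials in the `z i` have distinct sums. -/
def DistinctMonomialSums {A : Type*} [CommRing A] {d : ℕ} (z : Fin d → A) : Prop :=
  Function.Injective fun s : Finset (Fin d → ℕ) ↦ ∑ v ∈ s, ∏ i, z i ^ v i

theorem DistinctMonomialSums.of_map {A B : Type*} [CommRing A] [CommRing B] (f : A →+* B) {d : ℕ}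
    {z : Fin d → A} (h : DistinctMonomialSums fun i ↦ f (z i)) : DistinctMonomialSums z := by
  intro s t hst
  refine h ?_
  simpa only [map_sum, map_prod, map_pow] using congrArg f hst

theorem AlgebraicIndependent.distinctMonomialSums {R A : Type*} [CommRing R] [Nontrivial R]
    [CommRing A] [Algebra R A] {d : ℕ} {z : Fin d → A} (h : AlgebraicIndependent R z) :
    DistinctMonomialSums z := by
  have key : ∀ s : Finset (Fin d → ℕ), ∑ v ∈ s, ∏ i, z i ^ v i =
      MvPolynomial.aeval z
        (∑ v ∈ s, MvPolynomial.monomial (Finsupp.equivFunOnFinite.symm v) (1 : R)) := by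
    intro s
    rw [map_sum]
    refine Finset.sum_congr rfl fun v _ ↦ ?_
    rw [MvPolynomial.aeval_monomial, map_one, one_mul, Finsupp.prod_fintype _ _ (by simp)]
    rfl
  intro s t hst
  simp only [key] at hst
  have hst := h hst
  ext v
  have := congrArg (MvPolynomial.coeff (Finsupp.equivFunOnFinite.symm v)) hst
  simp only [MvPolynomial.coeff_sum, MvPolynomial.coeff_monomial,
    EmbeddingLike.apply_eq_iff_eq] at this
  by_cases h1 : v ∈ s <;> by_cases h2 : v ∈ t <;> simp_all

/-- Noether normalization of a quotient of a ring of finite type over `ℤ` by a prime number. -/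
theorem exists_isIntegral_quotient_prime (p : ℕ) [Fact p.Prime] (A : Type*) [CommRing A]
    [Algebra.FiniteType ℤ A] :
    ∃ (e : ℕ) (z : Fin e → A ⧸ Ideal.span {(p : A)}),
      (MvPolynomial.aeval z : MvPolynomial (Fin e) ℤ →ₐ[ℤ] _).IsIntegral ∧
      (e = 0 ∨ (e : WithBot ℕ∞) ≤ ringKrullDim A ∧ DistinctMonomialSums z) := by
  set I := Ideal.span {(p : A)} with hI
  rcases subsingleton_or_nontrivial (A ⧸ I) with h | h
  · exact ⟨0, Fin.elim0, fun a ↦ ⟨1, Polynomial.monic_one, Subsingleton.elim _ _⟩, .inl rfl⟩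
  have : CharP (A ⧸ I) p := CharP.quotient _ _ (by
    rw [mem_nonunits_iff, ← Ideal.span_singleton_eq_top]
    exact Ideal.Quotient.nontrivial_iff.mp h)
  let _ : Algebra (ZMod p) (A ⧸ I) := ZMod.algebra _ _
  have : Algebra.FiniteType (ZMod p) (A ⧸ I) := .of_restrictScalars_finiteType ℤ _ _
  obtain ⟨e, g, hg, hg'⟩ := exists_integral_inj_algHom_of_fg (ZMod p) (A ⧸ I)
  refine ⟨e, fun i ↦ g (MvPolynomial.X i), ?_, .inr ⟨?_, ?_⟩⟩
  · have key : (MvPolynomial.aeval fun i ↦ g (MvPolynomial.X i) :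
        MvPolynomial (Fin e) ℤ →ₐ[ℤ] A ⧸ I).toRingHom =
        g.toRingHom.comp (MvPolynomial.map (Int.castRingHom (ZMod p))) :=
      MvPolynomial.ringHom_ext' (RingHom.ext_int _ _) fun i ↦ by simp
    change RingHom.IsIntegral (AlgHom.toRingHom _)
    rw [key]
    exact RingHom.IsIntegral.trans _ _ (RingHom.isIntegral_of_surjective _
      (MvPolynomial.map_surjective _ ZMod.intCast_surjective)) hg'
  · have := le_ringKrullDim_of_isIntegral_of_injective g.toRingHom hg' hg
    rw [MvPolynomial.ringKrullDim_of_isNoetherianRing, ringKrullDim_eq_zero_of_field] at this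
    simp only [zero_add, Nat.card_eq_fintype_card, Fintype.card_fin] at this
    exact this.trans (ringKrullDim_quotient_le I)
  · refine AlgebraicIndependent.distinctMonomialSums (R := ZMod p) ?_
    have : MvPolynomial.aeval (fun i ↦ g (MvPolynomial.X i)) = g := by ext; simp
    rwa [AlgebraicIndependent, this]

theorem ringKrullDim_zmod (n : ℕ) (hn : 2 ≤ n) : ringKrullDim (ZMod n) = 0 := by
  have : NeZero n := ⟨by lia⟩
  have : Nontrivial (ZMod n) := ZMod.nontrivial_iff.mpr (by lia)
  exact ringKrullDimZero_iff_ringKrullDim_eq_zero.mp inferInstance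

theorem isIntegral_aeval_of_forall_primeFactors {n : ℕ} (hn : n ≠ 0) {A : Type*} [CommRing A]
    [Algebra (ZMod n) A] {d : ℕ} (y : Fin d → A)
    (h : ∀ p ∈ n.primeFactors, (MvPolynomial.aeval
      fun i ↦ Ideal.Quotient.mk (Ideal.span {(p : A)}) (y i) :
      MvPolynomial (Fin d) ℤ →ₐ[ℤ] A ⧸ Ideal.span {(p : A)}).IsIntegral) :
    (MvPolynomial.aeval y : MvPolynomial (Fin d) (ZMod n) →ₐ[ZMod n] A).IsIntegral := by
  have hn0 : (n : A) = 0 := by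
    rw [← map_natCast (algebraMap (ZMod n) A), ZMod.natCast_self, map_zero]
  have key : (MvPolynomial.aeval y : MvPolynomial (Fin d) (ZMod n) →ₐ[ZMod n] A).toRingHom.comp
      (MvPolynomial.map (Int.castRingHom (ZMod n))) =
      (MvPolynomial.aeval y : MvPolynomial (Fin d) ℤ →ₐ[ℤ] A).toRingHom :=
    MvPolynomial.ringHom_ext' (RingHom.ext_int _ _) fun i ↦ by simp
  refine RingHom.IsIntegral.tower_top (MvPolynomial.map (Int.castRingHom (ZMod n))) _ ?_
  change RingHom.IsIntegral (RingHom.comp (AlgHom.toRingHom _) _)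
  rw [key]
  intro a
  have hP : ∀ p ∈ n.primeFactors, ∃ P : Polynomial (MvPolynomial (Fin d) ℤ), P.Monic ∧
      (p : A) ∣ P.eval₂ (MvPolynomial.aeval y : MvPolynomial (Fin d) ℤ →ₐ[ℤ] A).toRingHom a := by
    intro p hp
    obtain ⟨P, hP, hP'⟩ := h p hp (Ideal.Quotient.mk _ a)
    refine ⟨P, hP, ?_⟩
    rw [← Ideal.mem_span_singleton, ← Ideal.Quotient.eq_zero_iff_mem, Polynomial.hom_eval₂,
      ← hP']
    congr 1
    exact MvPolynomial.ringHom_ext' (RingHom.ext_int _ _) fun i ↦ by simp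
  choose! P hP hP' using hP
  refine ⟨∏ p ∈ n.primeFactors, P p ^ n.factorization p,
    Polynomial.monic_prod_of_monic _ _ fun p hp ↦ (hP p hp).pow _, ?_⟩
  rw [Polynomial.eval₂_finsetProd]
  refine zero_dvd_iff.mp ?_
  rw [← hn0]
  conv_lhs => rw [← Nat.prod_factorization_pow_eq_self hn, Finsupp.prod, Nat.cast_prod]
  refine Finset.prod_dvd_prod_of_dvd _ _ fun p hp ↦ ?_
  rw [Nat.cast_pow, Polynomial.eval₂_pow]
  exact pow_dvd_pow_of_dvd (hP' p hp) _

/-- Noether normalization over `ZMod n`: the polynomial ring need not embed, but finite sums of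
distinct monomials are separated. -/
theorem exists_isIntegral_aeval_zmod (n : ℕ) (hn : 2 ≤ n) (A : Type*) [CommRing A] [Nontrivial A]
    [Algebra (ZMod n) A] [Algebra.FiniteType (ZMod n) A] :
    ∃ (d : ℕ) (y : Fin d → A),
      (MvPolynomial.aeval y : MvPolynomial (Fin d) (ZMod n) →ₐ[ZMod n] A).IsIntegral ∧
      ringKrullDim A = d ∧ (d = 0 ∨ DistinctMonomialSums y) := by
  have : NeZero n := ⟨by lia⟩
  have : Algebra.FiniteType ℤ (ZMod n) :=
    .of_surjective (Algebra.ofId ℤ (ZMod n)) ZMod.intCast_surjective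
  have : Algebra.FiniteType ℤ A := .trans (S := ZMod n) inferInstance inferInstance
  have H : ∀ p : n.primeFactors, _ := fun p ↦
    have : Fact (p : ℕ).Prime := ⟨Nat.prime_of_mem_primeFactors p.2⟩
    exists_isIntegral_quotient_prime p A
  choose e z hz hez using H
  set d := Finset.univ.sup e with hd
  have hed : ∀ p, e p ≤ d := fun p ↦ Finset.le_sup (Finset.mem_univ p)
  let z' (p) (i : Fin d) := if h : (i : ℕ) < e p then z p ⟨i, h⟩ else 0
  have hcop : Pairwise (Function.onFun IsCoprime
      fun p : n.primeFactors ↦ Ideal.span {((p : ℕ) : A)}) := by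
    intro p q hpq
    rw [Function.onFun, Ideal.isCoprime_span_singleton_iff]
    refine Nat.Coprime.cast ?_
    exact (Nat.coprime_primes (Nat.prime_of_mem_primeFactors p.2)
      (Nat.prime_of_mem_primeFactors q.2)).mpr (Subtype.coe_injective.ne hpq)
  choose y hy using fun i ↦ Ideal.pi_quotient_surjective hcop fun p ↦ z' p i
  have hyint : (MvPolynomial.aeval y : MvPolynomial (Fin d) (ZMod n) →ₐ[ZMod n] A).IsIntegral := by
    refine isIntegral_aeval_of_forall_primeFactors (by lia) y fun p hp ↦ ?_
    have key : (MvPolynomial.aeval fun i ↦ Ideal.Quotient.mk (Ideal.span {(p : A)}) (y i) :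
        MvPolynomial (Fin d) ℤ →ₐ[ℤ] A ⧸ Ideal.span {(p : A)}).toRingHom.comp
        (MvPolynomial.rename (R := ℤ) (Fin.castLE (hed ⟨p, hp⟩))).toRingHom =
        (MvPolynomial.aeval (z ⟨p, hp⟩) :
          MvPolynomial (Fin (e ⟨p, hp⟩)) ℤ →ₐ[ℤ] A ⧸ Ideal.span {(p : A)}).toRingHom := by
      refine MvPolynomial.ringHom_ext' (RingHom.ext_int _ _) fun i ↦ ?_
      simp [hy _ ⟨p, hp⟩, z']
    refine RingHom.IsIntegral.tower_top
      (MvPolynomial.rename (R := ℤ) (Fin.castLE (hed ⟨p, hp⟩))).toRingHom _ ?_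
    change RingHom.IsIntegral (RingHom.comp (AlgHom.toRingHom _) _)
    rw [key]
    exact hz ⟨p, hp⟩
  have hle : ringKrullDim A ≤ d := by
    refine (ringKrullDim_le_of_isIntegral _ hyint).trans ?_
    rw [MvPolynomial.ringKrullDim_of_isNoetherianRing, ringKrullDim_zmod n hn]
    simp
  rcases Nat.eq_zero_or_pos d with h0 | hpos
  · refine ⟨d, y, hyint, le_antisymm hle ?_, .inl h0⟩
    rw [h0]
    exact ringKrullDim_nonneg_of_nontrivial
  · have hne : (Finset.univ : Finset n.primeFactors).Nonempty := by
      by_contra! hempty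
      simp [hd, hempty] at hpos
    obtain ⟨p, -, hp⟩ := Finset.exists_mem_eq_sup _ hne e
    rw [← hd] at hp
    obtain ⟨h1, h2⟩ := (hez p).resolve_left (by lia)
    refine ⟨d, y, hyint, le_antisymm hle (by rwa [hp]), .inr ?_⟩
    refine .of_map (Ideal.Quotient.mk (Ideal.span {((p : ℕ) : A)})) ?_
    have hcast : ∀ (e' d' : ℕ) (_ : d' = e') (w : Fin e' → A ⧸ Ideal.span {((p : ℕ) : A)}),
        DistinctMonomialSums w → DistinctMonomialSums
          fun i : Fin d' ↦ if h : (i : ℕ) < e' then w ⟨i, h⟩ else 0 := by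
      rintro e' _ rfl w hw
      simpa using hw
    simpa only [hy _ p] using hcast _ _ hp _ h2

/-- The span of `1` and the `x i`. -/
def oneSpan {R A : Type*} [CommRing R] [CommRing A] [Algebra R A] {k : ℕ} (x : Fin k → A) :
    Submodule R A :=
  Submodule.span R (insert 1 (Set.range x))

section oneSpan

variable {R A : Type*} [CommRing R] [CommRing A] [Algebra R A] {k : ℕ} (x : Fin k → A)

theorem one_le_oneSpan : 1 ≤ oneSpan (R := R) x :=
  Submodule.one_le.mpr (Submodule.subset_span (Set.mem_insert _ _))

theorem mem_oneSpan (i : Fin k) : x i ∈ oneSpan (R := R) x :=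
  Submodule.subset_span (Set.mem_insert_of_mem _ ⟨i, rfl⟩)

theorem oneSpan_fg : (oneSpan (R := R) x).FG :=
  Submodule.fg_span ((Set.finite_range x).insert 1)

theorem finite_oneSpan_pow_mul [Finite R] {V : Submodule R A} (hV : V.FG) (m : ℕ) :
    Finite ↥(oneSpan (R := R) x ^ m * V) :=
  have : Module.Finite R ↥(oneSpan (R := R) x ^ m * V) :=
    Module.Finite.iff_fg.mpr (((oneSpan_fg x).pow m).mul hV)
  Module.finite_of_finite R

theorem oneSpan_le {F : Submodule R A} (h1 : 1 ≤ F) (hx : ∀ i, x i ∈ F) : oneSpan x ≤ F := by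
  refine Submodule.span_le.mpr (Set.insert_subset (Submodule.one_le.mp h1) ?_)
  rintro _ ⟨i, rfl⟩
  exact hx i

theorem prod_pow_mem_oneSpan_pow (v : Fin k → ℕ) :
    ∏ i, x i ^ v i ∈ oneSpan (R := R) x ^ ∑ i, v i := by
  induction (Finset.univ : Finset (Fin k)) using Finset.induction_on with
  | empty => simpa using Submodule.one_le.mp (le_refl (1 : Submodule R A))
  | insert i s hi ih =>
    rw [Finset.prod_insert hi, Finset.sum_insert hi, pow_add]
    exact Submodule.mul_mem_mul (Submodule.pow_mem_pow _ (mem_oneSpan x i) _) ih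

theorem aeval_mem_oneSpan_pow (p : MvPolynomial (Fin k) R) {m : ℕ} (hp : p.totalDegree ≤ m) :
    MvPolynomial.aeval x p ∈ oneSpan (R := R) x ^ m := by
  rw [MvPolynomial.aeval_def, MvPolynomial.eval₂_eq']
  refine Submodule.sum_mem _ fun v hv ↦ ?_
  rw [← Algebra.smul_def]
  refine Submodule.smul_mem _ _ (pow_le_pow_right₀ (one_le_oneSpan x) ?_
    (prod_pow_mem_oneSpan_pow x v))
  refine le_trans (le_of_eq ?_) ((MvPolynomial.le_totalDegree hv).trans hp)
  rw [Finsupp.sum_fintype _ _ (by simp)]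

theorem oneSpan_pow (m : ℕ) : oneSpan (R := R) x ^ m =
    (MvPolynomial.restrictTotalDegree (Fin k) R m).map (MvPolynomial.aeval x).toLinearMap := by
  refine le_antisymm ?_ ?_
  · induction m with
    | zero =>
      rw [pow_zero, Submodule.one_le]
      exact ⟨1, by simp [MvPolynomial.mem_restrictTotalDegree], by simp⟩
    | succ m ih =>
      rw [pow_succ]
      refine (mul_le_mul' ih le_rfl).trans ?_
      rw [Submodule.mul_le]
      rintro _ ⟨p, hp, rfl⟩ b hb
      have hb' : oneSpan x ≤ (MvPolynomial.restrictTotalDegree (Fin k) R 1).map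
          (MvPolynomial.aeval x).toLinearMap := by
        refine oneSpan_le x (Submodule.one_le.mpr ⟨1, ?_, by simp⟩) fun i ↦
          ⟨MvPolynomial.X i, ?_, by simp⟩
        · simp [MvPolynomial.mem_restrictTotalDegree]
        · exact (MvPolynomial.mem_restrictTotalDegree _ _ _).mpr
            (MvPolynomial.totalDegree_monomial_le _ _ |>.trans (by simp))
      obtain ⟨q, hq, rfl⟩ := hb' hb
      refine ⟨p * q, ?_, by simp⟩
      simp only [SetLike.mem_coe, MvPolynomial.mem_restrictTotalDegree] at hp hq ⊢
      exact (MvPolynomial.totalDegree_mul _ _).trans (add_le_add hp hq)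
  · rintro _ ⟨p, hp, rfl⟩
    exact aeval_mem_oneSpan_pow x p ((MvPolynomial.mem_restrictTotalDegree _ _ _).mp hp)

theorem exists_mem_oneSpan_pow_mul [Algebra (MvPolynomial (Fin k) R) A]
    (hx : ∀ p, algebraMap (MvPolynomial (Fin k) R) A p = MvPolynomial.aeval x p)
    {U : Submodule R A} {s : Set A} (hsU : s ⊆ U)
    (hs : Submodule.span (MvPolynomial (Fin k) R) s = ⊤) (a : A) :
    ∃ N, a ∈ oneSpan (R := R) x ^ N * U := by
  have ha : a ∈ Submodule.span (MvPolynomial (Fin k) R) s := hs ▸ Submodule.mem_top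
  obtain ⟨c, rfl⟩ := (Finsupp.mem_span_iff_linearCombination _ _ _).mp ha
  refine ⟨c.support.sup fun u ↦ (c u).totalDegree, ?_⟩
  rw [Finsupp.linearCombination_apply]
  refine Submodule.sum_mem _ fun u hu ↦ ?_
  simp only [Algebra.smul_def, hx]
  refine Submodule.mul_mem_mul (aeval_mem_oneSpan_pow x _ ?_) (hsU u.2)
  exact Finset.le_sup (f := fun u ↦ (c u).totalDegree) hu

variable {E U W F : Submodule R A}

theorem exists_le_pow_mul_of_fg (hE : 1 ≤ E) (h : ∀ a, ∃ N, a ∈ E ^ N * U) (hW : W.FG) :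
    ∃ N, W ≤ E ^ N * U := by
  obtain ⟨s, rfl⟩ := hW
  choose N hN using h
  refine ⟨s.sup N, Submodule.span_le.mpr fun a ha ↦ ?_⟩
  exact mul_le_mul' (pow_le_pow_right₀ hE (Finset.le_sup ha)) le_rfl (hN a)

theorem pow_mul_le_pow_mul {D : ℕ} (h : F * U ≤ E ^ D * U) (m : ℕ) :
    F ^ m * U ≤ E ^ (D * m) * U := by
  induction m with
  | zero => simp
  | succ m ih =>
    calc F ^ (m + 1) * U = F ^ m * (F * U) := by rw [pow_succ, mul_assoc]
      _ ≤ F ^ m * (E ^ D * U) := mul_le_mul' le_rfl h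
      _ = E ^ D * (F ^ m * U) := by ac_rfl
      _ ≤ E ^ D * (E ^ (D * m) * U) := mul_le_mul' le_rfl ih
      _ = E ^ (D * (m + 1)) * U := by rw [← mul_assoc, ← pow_add, mul_add, mul_one, add_comm]

theorem oneSpan_pow_le_span_prod (N : ℕ) :
    oneSpan (R := R) x ^ N ≤ Submodule.span R
      (Set.range fun v : Fin k → Fin (N + 1) ↦ ∏ i, x i ^ (v i : ℕ)) := by
  rw [oneSpan_pow]
  rintro _ ⟨p, hp, rfl⟩
  have hp := (MvPolynomial.mem_restrictTotalDegree _ _ _).mp hp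
  rw [AlgHom.toLinearMap_apply, MvPolynomial.aeval_def, MvPolynomial.eval₂_eq']
  refine Submodule.sum_mem _ fun v hv ↦ ?_
  rw [← Algebra.smul_def]
  refine Submodule.smul_mem _ _ (Submodule.subset_span ⟨fun i ↦ ⟨v i, ?_⟩, rfl⟩)
  have := (MvPolynomial.le_totalDegree hv).trans hp
  rw [Finsupp.sum_fintype _ _ (by simp)] at this
  have := Finset.single_le_sum (f := fun i ↦ v i) (fun _ _ ↦ Nat.zero_le _) (Finset.mem_univ i)
  lia

end oneSpan

theorem Submodule.natCard_span_range_le {R M ι : Type*} [CommRing R] [Finite R] [AddCommGroup M]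
    [Module R M] [Finite ι] (f : ι → M) :
    Nat.card (Submodule.span R (Set.range f)) ≤ Nat.card R ^ Nat.card ι := by
  have := Fintype.ofFinite ι
  rw [← Fintype.range_linearCombination R, ← Nat.card_fun]
  exact Nat.card_le_card_of_surjective _ (LinearMap.surjective_rangeRestrict _)

theorem natCard_oneSpan_pow_mul_le {R A : Type*} [CommRing R] [Finite R] [CommRing A]
    [Algebra R A] {d : ℕ} (y : Fin d → A) (s : Finset A) (N : ℕ) :
    Nat.card ↥(oneSpan (R := R) y ^ N * Submodule.span R (s : Set A)) ≤
      Nat.card R ^ ((N + 1) ^ d * s.card) := by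
  have hle : oneSpan (R := R) y ^ N * Submodule.span R (s : Set A) ≤ Submodule.span R
      (Set.range fun vu : (Fin d → Fin (N + 1)) × s ↦ (∏ i, y i ^ (vu.1 i : ℕ)) * (vu.2 : A)) := by
    refine (mul_le_mul' (oneSpan_pow_le_span_prod y N) le_rfl).trans ?_
    rw [Submodule.span_mul_span, Submodule.span_le]
    rintro _ ⟨_, ⟨v, rfl⟩, u, hu, rfl⟩
    exact Submodule.subset_span ⟨(v, ⟨u, hu⟩), rfl⟩
  have : Finite ↥(Submodule.span R (Set.range fun vu : (Fin d → Fin (N + 1)) × s ↦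
      (∏ i, y i ^ (vu.1 i : ℕ)) * (vu.2 : A))) :=
    have : Module.Finite R ↥(Submodule.span R (Set.range fun vu : (Fin d → Fin (N + 1)) × s ↦
      (∏ i, y i ^ (vu.1 i : ℕ)) * (vu.2 : A))) := .span_of_finite _ (Set.finite_range _)
    Module.finite_of_finite R
  refine (Nat.card_le_card_of_injective _ (Submodule.inclusion_injective hle)).trans ?_
  refine (Submodule.natCard_span_range_le _).trans (le_of_eq ?_)
  simp

theorem DistinctMonomialSums.le_natCard {R A : Type*} [CommRing R] [CommRing A]
    [Algebra R A] {d : ℕ} {y : Fin d → A} (hy : DistinctMonomialSums y) (m : ℕ)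
    (W : Submodule R A) [Finite W] (hW : oneSpan (R := R) y ^ (d * m) ≤ W) :
    2 ^ (m + 1) ^ d ≤ Nat.card W := by
  let B : Finset (Fin d → ℕ) := Fintype.piFinset fun _ ↦ Finset.range (m + 1)
  have hB : Nat.card B.powerset = 2 ^ (m + 1) ^ d := by
    rw [Nat.card_eq_fintype_card, Fintype.card_coe, Finset.card_powerset, Fintype.card_piFinset]
    simp
  rw [← hB]
  refine Nat.card_le_card_of_injective
    (fun s ↦ ⟨∑ v ∈ s.1, ∏ i, y i ^ v i, hW (Submodule.sum_mem _ fun v hv ↦ ?_)⟩) ?_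
  · refine pow_le_pow_right₀ (one_le_oneSpan y) ?_ (prod_pow_mem_oneSpan_pow y v)
    have hv := Fintype.mem_piFinset.mp (Finset.mem_powerset.mp s.2 hv)
    calc ∑ i, v i ≤ ∑ _ : Fin d, m :=
          Finset.sum_le_sum fun i _ ↦ by have := Finset.mem_range.mp (hv i); lia
      _ = d * m := by simp
  · intro s t hst
    exact Subtype.ext (hy (congrArg Subtype.val hst))

theorem degSmul_eq_oneSpan_pow_mul {R : Type} [CommRing R] {k : ℕ}
    (J : Ideal (MvPolynomial (Fin k) R)) (m : ℕ) (V : Submodule R (MvPolynomial (Fin k) R ⧸ J)) :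
    degSmul k m V = oneSpan (R := R) (fun i ↦ Ideal.Quotient.mk J (MvPolynomial.X i)) ^ m * V := by
  have hx : MvPolynomial.aeval (fun i ↦ Ideal.Quotient.mk J (MvPolynomial.X i)) =
      Ideal.Quotient.mkₐ R J := by ext; simp
  have hsmul (p : MvPolynomial (Fin k) R) (v : MvPolynomial (Fin k) R ⧸ J) :
      p • v = Ideal.Quotient.mk J p * v := by
    obtain ⟨v, rfl⟩ := Ideal.Quotient.mk_surjective v
    rfl
  refine le_antisymm (Submodule.span_le.mpr ?_) ?_
  · rintro _ ⟨p, hp, v, hv, rfl⟩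
    have := aeval_mem_oneSpan_pow (fun i ↦ Ideal.Quotient.mk J (MvPolynomial.X i)) p
      ((MvPolynomial.mem_restrictTotalDegree _ _ _).mp hp)
    rw [hx] at this
    rw [hsmul]
    exact Submodule.mul_mem_mul this hv
  · rw [oneSpan_pow, Submodule.mul_le, hx]
    rintro _ ⟨p, hp, rfl⟩ v hv
    exact Submodule.subset_span ⟨p, hp, v, hv, hsmul p v⟩

/-- Polynomial growth of `oneSpan x ^ m * V` whose exponent is the Krull dimension. -/
theorem exists_natCard_oneSpan_pow_mul_bounds (n : ℕ) (hn : 2 ≤ n) {A : Type*} [CommRing A]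
    [Nontrivial A] [Algebra (ZMod n) A] {k : ℕ} (x : Fin k → A)
    (hx : Function.Surjective (MvPolynomial.aeval (R := ZMod n) x))
    {V : Submodule (ZMod n) A} (hVfg : V.FG)
    (hV : ∀ a, ∃ N, a ∈ oneSpan (R := ZMod n) x ^ N * V) :
    ∃ d : ℕ, ringKrullDim A = d ∧
      (∃ r c D : ℕ, ∀ m,
        Nat.card ↥(oneSpan (R := ZMod n) x ^ m * V) ≤ n ^ ((c + D * m + 1) ^ d * r)) ∧
      (d = 0 ∨ ∃ c D : ℕ, 0 < D ∧ ∀ m,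
        2 ^ (m + 1) ^ d ≤ Nat.card ↥(oneSpan (R := ZMod n) x ^ (D * m + c) * V)) := by
  have : NeZero n := ⟨by lia⟩
  have : Algebra.FiniteType (ZMod n) A := .of_surjective _ hx
  obtain ⟨d, y, hy, hd, hmon⟩ := exists_isIntegral_aeval_zmod n hn A
  have hfin := finite_oneSpan_pow_mul (R := ZMod n) x hVfg
  refine ⟨d, hd, ?_, ?_⟩
  · have hyfin : (MvPolynomial.aeval (R := ZMod n) y).toRingHom.Finite :=
      RingHom.IsIntegral.to_finite hy (RingHom.FiniteType.of_comp_finiteType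
        (f := algebraMap (ZMod n) (MvPolynomial (Fin d) (ZMod n))) (by
          rw [AlgHom.toRingHom_eq_coe, AlgHom.comp_algebraMap]
          exact RingHom.finiteType_algebraMap.mpr inferInstance))
    let _ : Algebra (MvPolynomial (Fin d) (ZMod n)) A :=
      (MvPolynomial.aeval (R := ZMod n) y).toRingHom.toAlgebra
    obtain ⟨s, hs⟩ : (⊤ : Submodule (MvPolynomial (Fin d) (ZMod n)) A).FG := hyfin.1
    have hU := exists_mem_oneSpan_pow_mul y (fun _ ↦ rfl)
      (Submodule.subset_span (R := ZMod n) (s := (s : Set A))) hs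
    obtain ⟨c, hc⟩ := exists_le_pow_mul_of_fg (one_le_oneSpan y) hU hVfg
    obtain ⟨D, hD⟩ := exists_le_pow_mul_of_fg (one_le_oneSpan y) hU
      ((oneSpan_fg x).mul (Submodule.fg_span s.finite_toSet))
    refine ⟨s.card, c, D, fun m ↦ ?_⟩
    have hle : oneSpan (R := ZMod n) x ^ m * V ≤
        oneSpan y ^ (c + D * m) * Submodule.span (ZMod n) (s : Set A) :=
      calc oneSpan (R := ZMod n) x ^ m * V
          ≤ oneSpan x ^ m * (oneSpan y ^ c * Submodule.span (ZMod n) (s : Set A)) :=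
            mul_le_mul' le_rfl hc
        _ = oneSpan y ^ c * (oneSpan x ^ m * Submodule.span (ZMod n) (s : Set A)) := by ac_rfl
        _ ≤ oneSpan y ^ c * (oneSpan y ^ (D * m) * Submodule.span (ZMod n) (s : Set A)) :=
            mul_le_mul' le_rfl (pow_mul_le_pow_mul hD m)
        _ = _ := by rw [← mul_assoc, ← pow_add]
    have := finite_oneSpan_pow_mul (R := ZMod n) y (Submodule.fg_span s.finite_toSet) (c + D * m)
    refine (Nat.card_le_card_of_injective _ (Submodule.inclusion_injective hle)).trans ?_
    simpa using natCard_oneSpan_pow_mul_le (R := ZMod n) y s (c + D * m)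
  · rcases Nat.eq_zero_or_pos d with rfl | hdpos
    · exact .inl rfl
    right
    have hmon := hmon.resolve_left hdpos.ne'
    have h1 (a : A) : ∃ N, a ∈ oneSpan (R := ZMod n) x ^ N * 1 := by
      obtain ⟨p, rfl⟩ := hx a
      exact ⟨p.totalDegree, by rw [mul_one]; exact aeval_mem_oneSpan_pow x p le_rfl⟩
    obtain ⟨D, hD⟩ := exists_le_pow_mul_of_fg (one_le_oneSpan x) h1 (oneSpan_fg y)
    obtain ⟨c, hc⟩ := exists_le_pow_mul_of_fg (one_le_oneSpan x) hV (W := 1)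
      (Submodule.one_eq_span (R := ZMod n) (A := A) ▸ Submodule.fg_span_singleton 1)
    rw [mul_one] at hD
    refine ⟨c, (D + 1) * d, by positivity, fun m ↦ hmon.le_natCard m _ ?_⟩
    calc oneSpan (R := ZMod n) y ^ (d * m)
        ≤ (oneSpan x ^ (D + 1)) ^ (d * m) * 1 := by
          rw [mul_one]
          exact pow_le_pow_left' (hD.trans (pow_le_pow_right₀ (one_le_oneSpan x) (by lia))) _
      _ ≤ (oneSpan x ^ (D + 1)) ^ (d * m) * (oneSpan x ^ c * V) := mul_le_mul' le_rfl hc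
      _ = oneSpan x ^ ((D + 1) * d * m + c) * V := by
          rw [← mul_assoc, ← pow_mul, ← pow_add, mul_assoc]

open Filter in
/-- Fix `2 ≤ n`, let `R := ℤ/(n)`, and let `λ` be the length function on
`R`-modules given by `λ(M) = log_n (card M)` (with `λ(M) = ∞` for infinite `M`).  Let
`S = R[x₁,…,x_k]`, `J < S` a (proper) ideal and `A := S/J`.  Then the λ-dimension of `A` equals
the Krull dimension of `A`: for every finitely generated `R`-submodule `V₀ ≤ A` of finite length
with `S·V₀ = A` and every polynomial `q` with `λ(Sₘ·V₀) = q(m)` for all large `m`, the degree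
of `q` equals the Krull dimension of `A`. -/
theorem stmt_18 (n : ℕ) (hn : 2 ≤ n) (L : LengthFunction (ZMod n))
    (hLfin : ∀ (M : Type) [AddCommGroup M] [Module (ZMod n) M],
      Finite M → L.l M = ENNReal.ofReal (Real.logb n (Nat.card M)))
    (hLinf : ∀ (M : Type) [AddCommGroup M] [Module (ZMod n) M],
      Infinite M → L.l M = ⊤)
    {k : ℕ} (J : Ideal (MvPolynomial (Fin k) (ZMod n))) (hJ : J ≠ ⊤) :
    ∀ V₀ : Submodule (ZMod n) (MvPolynomial (Fin k) (ZMod n) ⧸ J),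
      V₀.FG → L.l V₀ < ⊤ →
      Submodule.span (MvPolynomial (Fin k) (ZMod n))
        (V₀ : Set (MvPolynomial (Fin k) (ZMod n) ⧸ J)) = ⊤ →
      ∀ q : Polynomial ℝ,
        (∀ᶠ m : ℕ in atTop, (L.l (degSmul k m V₀)).toReal = q.eval (m : ℝ)) →
        (q.natDegree : WithBot ℕ∞) = ringKrullDim (MvPolynomial (Fin k) (ZMod n) ⧸ J) := by
  intro V₀ hfg hlt hspan q hq
  have : NeZero n := ⟨by lia⟩
  have : Nontrivial (MvPolynomial (Fin k) (ZMod n) ⧸ J) := Ideal.Quotient.nontrivial_iff.mpr hJ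
  set x : Fin k → MvPolynomial (Fin k) (ZMod n) ⧸ J :=
    fun i ↦ Ideal.Quotient.mk J (MvPolynomial.X i)
  have hx : MvPolynomial.aeval x = Ideal.Quotient.mkₐ (ZMod n) J := by ext; simp [x]
  obtain ⟨d, hd, ⟨r, c, D, hup⟩, hlow⟩ := exists_natCard_oneSpan_pow_mul_bounds n hn x
    (hx ▸ Ideal.Quotient.mkₐ_surjective _ J) hfg
    (exists_mem_oneSpan_pow_mul x (fun p ↦ by rw [hx]; rfl) subset_rfl hspan)
  have hn1 : (1 : ℝ) < n := by exact_mod_cast hn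
  have hfin := finite_oneSpan_pow_mul (R := ZMod n) x hfg
  have hcard : ∀ m, (L.l (degSmul k m V₀)).toReal =
      Real.logb n (Nat.card ↥(oneSpan (R := ZMod n) x ^ m * V₀)) := by
    intro m
    rw [degSmul_eq_oneSpan_pow_mul]
    rw [hLfin _ (hfin m), ENNReal.toReal_ofReal]
    exact Real.logb_nonneg hn1 (by exact_mod_cast Nat.card_pos)
  simp only [hcard] at hq
  rw [hd]
  suffices q.natDegree = d by rw [this]
  refine le_antisymm ?_ ?_
  · refine q.natDegree_le_of_eventually_le ((c + D + 1) ^ d * r) d ?_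
    filter_upwards [hq, eventually_ge_atTop 1] with m hm hm1
    have hpos : (0 : ℝ) < Nat.card ↥(oneSpan (R := ZMod n) x ^ m * V₀) := by
      exact_mod_cast Nat.card_pos
    rw [← hm, abs_of_nonneg (Real.logb_nonneg hn1 (by exact_mod_cast hpos))]
    have h1 : (Nat.card ↥(oneSpan (R := ZMod n) x ^ m * V₀) : ℝ) ≤
        (n : ℝ) ^ ((c + D * m + 1) ^ d * r) := by exact_mod_cast hup m
    refine (Real.logb_le_logb_of_le hn1 hpos h1).trans ?_
    rw [Real.logb_pow, Real.logb_self_eq_one hn1, mul_one]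
    have h2 : c + D * m + 1 ≤ (c + D + 1) * m := by nlinarith
    have h3 : (c + D * m + 1) ^ d * r ≤ ((c + D + 1) * m) ^ d * r := by gcongr
    calc (((c + D * m + 1) ^ d * r : ℕ) : ℝ) ≤ (((c + D + 1) * m) ^ d * r : ℕ) := by
          exact_mod_cast h3
      _ = _ := by push_cast; rw [mul_pow]; ring
  · obtain rfl | ⟨c, D, hD, hlow⟩ := hlow
    · exact Nat.zero_le _
    have hdeg : (q.comp (Polynomial.C (D : ℝ) * Polynomial.X + Polynomial.C (c : ℝ))).natDegree =
        q.natDegree := by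
      rw [Polynomial.natDegree_comp, Polynomial.natDegree_linear (by positivity), mul_one]
    rw [← hdeg]
    refine Polynomial.le_natDegree_of_eventually_le _ (Real.logb n 2)
      (Real.logb_pos hn1 one_lt_two) d ?_
    have htends : Tendsto (fun m ↦ D * m + c) atTop atTop :=
      tendsto_atTop_mono (fun m ↦ (Nat.le_mul_of_pos_left m hD).trans le_self_add) tendsto_id
    filter_upwards [htends.eventually hq] with m hm
    have h1 : (2 : ℝ) ^ (m + 1) ^ d ≤ Nat.card ↥(oneSpan (R := ZMod n) x ^ (D * m + c) * V₀) := by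
      exact_mod_cast hlow m
    have h2 := Real.logb_le_logb_of_le hn1 (by positivity) h1
    rw [hm, Real.logb_pow] at h2
    simp only [Polynomial.eval_comp, Polynomial.eval_add, Polynomial.eval_mul, Polynomial.eval_C,
      Polynomial.eval_X]
    push_cast at h2
    refine le_trans ?_ h2
    rw [mul_comm]
    have := Real.logb_pos hn1 one_lt_two
    gcongr
    linarith
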